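/- Let E be a Banach space, let f : ℝ^d → E be a Lebesgue measurable function, let Q ⊆ ℝ^d be a Lebesgue measurable set with 0 < |Q| < ∞, and let 0 < λ ≤ κ < 1/2. Then for every quasi-optimal center of oscillation m of f on Q with a κ-portion disregarded, one has ρ_λ(f − m; Q) ≤ 4 ω_λ(f; Q). -/

import Mathlib

open MeasureTheory Set

/-- The least bound `ρ_λ(f;Q)`: the infimum of all `r ≥ 0` such that
`|{x ∈ Q : ‖f(x)‖ > r}| ≤ λ|Q|`. -/
noncomputable def leastBound {E : Type*} [NormedAddCommGroup E] {d : ℕ} (lam : ℝ)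
    (f : (Fin d → ℝ) → E) (Q : Set (Fin d → ℝ)) : ℝ :=
  sInf {r : ℝ | 0 ≤ r ∧ volume {x ∈ Q | r < ‖f x‖} ≤ ENNReal.ofReal lam * volume Q}

/-- The local oscillation `ω_λ(f;Q) := inf_{c ∈ E} ρ_λ(f - c; Q)`. -/
noncomputable def localOsc {E : Type*} [NormedAddCommGroup E] {d : ℕ} (lam : ℝ)
    (f : (Fin d → ℝ) → E) (Q : Set (Fin d → ℝ)) : ℝ :=
  ⨅ c : E, leastBound lam (fun x => f x - c) Q

/-- A quasi-optimal center of oscillation of `f` on `Q` with a `λ`-portion disregarded: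
any `m ∈ E` with `ρ_λ(f - m; Q) ≤ 2 ω_λ(f;Q)`. -/
def IsQuasiCenter {E : Type*} [NormedAddCommGroup E] {d : ℕ} (lam : ℝ)
    (f : (Fin d → ℝ) → E) (Q : Set (Fin d → ℝ)) (m : E) : Prop :=
  leastBound lam (fun x => f x - m) Q ≤ 2 * localOsc lam f Q

section LeastBound

variable {E : Type*} [NormedAddCommGroup E] {d : ℕ} {lam kap r : ℝ}
  {f : (Fin d → ℝ) → E} {Q : Set (Fin d → ℝ)}

theorem leastBound_nonneg : 0 ≤ leastBound lam f Q :=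
  Real.sInf_nonneg fun _ h => h.1

theorem leastBound_le (hr : 0 ≤ r)
    (h : volume {x ∈ Q | r < ‖f x‖} ≤ ENNReal.ofReal lam * volume Q) :
    leastBound lam f Q ≤ r :=
  csInf_le ⟨0, fun _ h => h.1⟩ ⟨hr, h⟩

/-- A measurable function is bounded off an arbitrarily small portion of a set of positive
finite measure. -/
theorem exists_measure_norm_gt_le (hf : AEStronglyMeasurable f volume)
    (hQmeas : MeasurableSet Q) (hQpos : 0 < volume Q) (hQfin : volume Q < ⊤) (hlam : 0 < lam) :
    ∃ r : ℝ, 0 ≤ r ∧ volume {x ∈ Q | r < ‖f x‖} ≤ ENNReal.ofReal lam * volume Q := by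
  have hlim := tendsto_measure_iInter_atTop (μ := volume)
    (s := fun n : ℕ => {x ∈ Q | (n : ℝ) < ‖f x‖})
    (fun n => hQmeas.nullMeasurableSet.inter
      (nullMeasurableSet_lt aemeasurable_const hf.norm.aemeasurable))
    (fun a b hab x hx => ⟨hx.1, lt_of_le_of_lt (Nat.cast_le.2 hab) hx.2⟩)
    ⟨0, ((measure_mono fun x hx => hx.1).trans_lt hQfin).ne⟩
  have hempty : ⋂ n : ℕ, {x ∈ Q | (n : ℝ) < ‖f x‖} = ∅ := by
    refine Set.eq_empty_iff_forall_notMem.2 fun x hx => ?_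
    obtain ⟨n, hn⟩ := exists_nat_gt ‖f x‖
    exact lt_asymm hn (Set.mem_iInter.1 hx n).2
  rw [hempty, measure_empty] at hlim
  have hpos : 0 < ENNReal.ofReal lam * volume Q :=
    ENNReal.mul_pos (ENNReal.ofReal_pos.2 hlam).ne' hQpos.ne'
  obtain ⟨n, hn⟩ := (hlim.eventually (gt_mem_nhds hpos)).exists
  exact ⟨n, n.cast_nonneg, hn.le⟩

theorem measure_norm_gt_le_of_leastBound_lt (hf : AEStronglyMeasurable f volume)
    (hQmeas : MeasurableSet Q) (hQpos : 0 < volume Q) (hQfin : volume Q < ⊤) (hlam : 0 < lam)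
    (hr : leastBound lam f Q < r) :
    volume {x ∈ Q | r < ‖f x‖} ≤ ENNReal.ofReal lam * volume Q := by
  obtain ⟨s, hs, hsr⟩ := exists_lt_of_csInf_lt
    (exists_measure_norm_gt_le hf hQmeas hQpos hQfin hlam) hr
  refine le_trans (measure_mono ?_) hs.2
  exact fun x hx => ⟨hx.1, hsr.trans hx.2⟩

theorem leastBound_anti (hf : AEStronglyMeasurable f volume)
    (hQmeas : MeasurableSet Q) (hQpos : 0 < volume Q) (hQfin : volume Q < ⊤) (hlam : 0 < lam)
    (hlk : lam ≤ kap) : leastBound kap f Q ≤ leastBound lam f Q :=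
  csInf_le_csInf ⟨0, fun _ h => h.1⟩ (exists_measure_norm_gt_le hf hQmeas hQpos hQfin hlam)
    fun _ h => ⟨h.1, h.2.trans (by gcongr)⟩

theorem localOsc_le (c : E) : localOsc lam f Q ≤ leastBound lam (fun x => f x - c) Q :=
  ciInf_le ⟨0, Set.forall_mem_range.2 fun _ => leastBound_nonneg⟩ c

/-- If `f` is within `r` of `c` and within `s` of `m` off portions of `Q` of total size less
than `1`, then `‖c - m‖ ≤ r + s`. -/
theorem norm_sub_le_of_measure_norm_gt_le {c m : E} {s : ℝ} (hQpos : 0 < volume Q)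
    (hQfin : volume Q < ⊤) (hlam : 0 ≤ lam) (hkap : 0 ≤ kap) (hsum : lam + kap < 1)
    (hc : volume {x ∈ Q | r < ‖f x - c‖} ≤ ENNReal.ofReal lam * volume Q)
    (hm : volume {x ∈ Q | s < ‖f x - m‖} ≤ ENNReal.ofReal kap * volume Q) :
    ‖c - m‖ ≤ r + s := by
  by_contra! hlt
  have hcover : Q ⊆ {x ∈ Q | r < ‖f x - c‖} ∪ {x ∈ Q | s < ‖f x - m‖} := by
    intro x hx
    by_contra hx'
    simp only [Set.mem_union, Set.mem_ofPred_eq, hx, true_and, not_or, not_lt] at hx'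
    have := norm_sub_le_norm_sub_add_norm_sub c (f x) m
    rw [norm_sub_rev c (f x)] at this
    linarith
  have hle : volume Q ≤ ENNReal.ofReal (lam + kap) * volume Q :=
    calc volume Q ≤ _ := (measure_mono hcover).trans (measure_union_le _ _)
      _ ≤ ENNReal.ofReal lam * volume Q + ENNReal.ofReal kap * volume Q := add_le_add hc hm
      _ = _ := by rw [ENNReal.ofReal_add hlam hkap, add_mul]
  have hlt' : ENNReal.ofReal (lam + kap) * volume Q < 1 * volume Q :=
    ENNReal.mul_lt_mul_left hQpos.ne' hQfin.ne (ENNReal.ofReal_lt_one.2 hsum)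
  rw [one_mul] at hlt'
  exact hle.not_gt hlt'

end LeastBound

/-- for `0 < λ ≤ κ < 1/2`, any quasi-optimal center of oscillation `m`
of `f` on `Q` with a `κ`-portion disregarded satisfies `ρ_λ(f - m; Q) ≤ 4 ω_λ(f;Q)`. -/
theorem leastBound_quasiCenter_le_four_localOsc {E : Type*} [NormedAddCommGroup E]
    [NormedSpace ℝ E] [CompleteSpace E] {d : ℕ}
    (f : (Fin d → ℝ) → E) (hf : AEStronglyMeasurable f volume)
    (Q : Set (Fin d → ℝ)) (hQmeas : MeasurableSet Q)
    (hQpos : 0 < volume Q) (hQfin : volume Q < ⊤)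
    (lam kap : ℝ) (hlam0 : 0 < lam) (hlk : lam ≤ kap) (hkap : kap < 1 / 2)
    (m : E) (hm : IsQuasiCenter kap f Q m) :
    leastBound lam (fun x => f x - m) Q ≤ 4 * localOsc lam f Q := by
  have hkap0 := hlam0.trans_le hlk
  have hsub (c : E) : AEStronglyMeasurable (fun x => f x - c) volume :=
    hf.sub aestronglyMeasurable_const
  suffices h : leastBound lam (fun x => f x - m) Q / 4 ≤ localOsc lam f Q by linarith
  refine le_ciInf fun c => le_of_forall_gt_imp_ge_of_dense fun r hr => ?_
  have hr0 : 0 ≤ r := leastBound_nonneg.trans hr.le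
  have hs : leastBound kap (fun x => f x - m) Q < 2 * r := by
    have h1 := leastBound_anti (hsub c) hQmeas hQpos hQfin hlam0 hlk
    have h2 := localOsc_le (lam := kap) (f := f) (Q := Q) c
    unfold IsQuasiCenter at hm
    linarith
  have hc := measure_norm_gt_le_of_leastBound_lt (hsub c) hQmeas hQpos hQfin hlam0 hr
  have hcm := norm_sub_le_of_measure_norm_gt_le hQpos hQfin hlam0.le hkap0.le (by linarith) hc
    (measure_norm_gt_le_of_leastBound_lt (hsub m) hQmeas hQpos hQfin hkap0 hs)
  have hle : leastBound lam (fun x => f x - m) Q ≤ 4 * r := by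
    refine leastBound_le (by linarith) (le_trans (measure_mono ?_) hc)
    refine fun x hx => ⟨hx.1, ?_⟩
    have := norm_sub_le_norm_sub_add_norm_sub (f x) c m
    linarith [hx.2]
  linarith
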